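/- Let A₊ ⊆ ℝⁿ be a finite affinely independent set and let A₋ ⊆ conv(A₊) be a nonempty finite set disjoint from A₊; for b ∈ A₋ let (λ^b_a)_{a∈A₊} be the barycentric coordinates of b with respect to A₊ (λ^b_a ≥ 0, ∑_{a∈A₊} λ^b_a = 1, ∑_{a∈A₊} λ^b_a a = b). Let f be the signomial with signed support (A₊,A₋) and positive coefficients c, and suppose f has a positive singular zero. Then there exist signomials (q_b)_{b∈A₋} such that f = ∑_{b∈A₋} q_b on ℝⁿ_{>0}, each q_b is copositive, and each q_b has the form q_b(x) = ∑_{a∈A₊, λ^b_a > 0} d_{b,a} x^a − c_b x^b with d_{b,a} > 0; in particular each q_b is a copositive circuit signomial whose single negative exponent is b and whose positive support is {a ∈ A₊ : λ^b_a > 0}, the vertex set of the smallest face of the simplex conv(A₊) containing b in its relative interior. -/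

import Mathlib

open Finset

attribute [local instance] Classical.propDecidable

/-- A monomial with real exponents takes a weighted sum of exponents to the product of powers. -/
theorem prod_rpow_sum_smul {ι : Type*} [Fintype ι] (s : Finset (ι → ℝ)) (w : (ι → ℝ) → ℝ)
    {x : ι → ℝ} (hx : ∀ i, 0 < x i) :
    ∏ j, x j ^ (∑ a ∈ s, w a • a) j = ∏ a ∈ s, (∏ j, x j ^ a j) ^ w a := by
  have h : ∀ a ∈ s, (∏ j, x j ^ a j) ^ w a = ∏ j, x j ^ (w a * a j) := fun a _ => by
    rw [← Real.finsetProd_rpow _ _ fun j _ => (Real.rpow_pos_of_pos (hx j) _).le]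
    exact Finset.prod_congr rfl fun j _ => by rw [← Real.rpow_mul (hx j).le, mul_comm]
  rw [Finset.prod_congr rfl h, Finset.prod_comm]
  refine Finset.prod_congr rfl fun j _ => ?_
  rw [Finset.sum_apply, Real.rpow_sum_of_pos (hx j)]
  simp

/-- Weighted AM-GM for monomials, normalized at a point `z`. -/
theorem div_prod_rpow_le_sum_div {ι : Type*} [Fintype ι] (s : Finset (ι → ℝ))
    (w : (ι → ℝ) → ℝ) (hw : ∀ a ∈ s, 0 ≤ w a) (hw1 : ∑ a ∈ s, w a = 1)
    {x z : ι → ℝ} (hx : ∀ i, 0 < x i) (hz : ∀ i, 0 < z i) :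
    (∏ j, x j ^ (∑ a ∈ s, w a • a) j) / (∏ j, z j ^ (∑ a ∈ s, w a • a) j) ≤
      ∑ a ∈ s, w a * ((∏ j, x j ^ a j) / ∏ j, z j ^ a j) := by
  have hpos : ∀ {y : ι → ℝ}, (∀ i, 0 < y i) → ∀ a : ι → ℝ, 0 < ∏ j, y j ^ a j :=
    fun hy a => Finset.prod_pos fun j _ => Real.rpow_pos_of_pos (hy j) _
  refine le_trans (le_of_eq ?_) (Real.geom_mean_le_arith_mean_weighted s w
    (fun a => (∏ j, x j ^ a j) / ∏ j, z j ^ a j) hw hw1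
    fun a _ => (div_pos (hpos hx a) (hpos hz a)).le)
  rw [prod_rpow_sum_smul s w hx, prod_rpow_sum_smul s w hz, ← Finset.prod_div_distrib]
  exact Finset.prod_congr rfl fun a _ =>
    (Real.div_rpow (hpos hx a).le (hpos hz a).le _).symm

/-- If points of an affinely independent set and points with given barycentric coordinates have
the same total mass and the same moment, then the masses are determined by the coordinates. -/
theorem AffineIndependent.eq_sum_mul_of_sum_smul_eq {V : Type*} [AddCommGroup V] [Module ℝ V]
    {s t : Finset V} (hs : AffineIndependent ℝ (fun p : {x // x ∈ s} => (p : V)))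
    {lam : V → V → ℝ} (hlam1 : ∀ b ∈ t, ∑ a ∈ s, lam b a = 1)
    (hlamb : ∀ b ∈ t, ∑ a ∈ s, lam b a • a = b) {u v : V → ℝ}
    (hmass : ∑ a ∈ s, u a = ∑ b ∈ t, v b)
    (hmoment : ∑ a ∈ s, u a • a = ∑ b ∈ t, v b • b) :
    ∀ a ∈ s, u a = ∑ b ∈ t, v b * lam b a := by
  intro a ha
  have h0 : ∑ a ∈ s, (u a - ∑ b ∈ t, v b * lam b a) = 0 := by
    rw [Finset.sum_sub_distrib, Finset.sum_comm, hmass, sub_eq_zero]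
    exact Finset.sum_congr rfl fun b hb => by rw [← Finset.mul_sum, hlam1 b hb, mul_one]
  have h1 : ∑ a ∈ s, (u a - ∑ b ∈ t, v b * lam b a) • a = 0 := by
    simp_rw [sub_smul, Finset.sum_smul]
    rw [Finset.sum_sub_distrib, Finset.sum_comm, hmoment, sub_eq_zero]
    refine Finset.sum_congr rfl fun b hb => ?_
    simp_rw [mul_smul]
    rw [← Finset.smul_sum, hlamb b hb]
  have h := affineIndependent_iff.1 hs Finset.univ (fun p => u p - ∑ b ∈ t, v b * lam b p)
    (by rw [← h0, ← Finset.sum_coe_sort s])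
    (by rw [← h1, ← Finset.sum_coe_sort s]) ⟨a, ha⟩ (Finset.mem_univ _)
  exact sub_eq_zero.1 h

/-- **SONC decomposition of singular extended-circuit signomials.** Let `A₊` be a finite
affinely independent set, `A₋ ⊆ conv(A₊)` nonempty and disjoint from `A₊` with
barycentric coordinates `λ^b`. If the signomial `f` with signed support `(A₊,A₋)` has a
positive singular zero, then `f = ∑_{b∈A₋} q_b` where each `q_b` is a copositive circuit
signomial of the form `q_b(x) = ∑_{a : λ^b_a > 0} d_{b,a} x^a − c_b x^b`. -/
theorem stmt14 {n : ℕ} (Ap Am : Finset (Fin n → ℝ)) (hdisj : Disjoint Ap Am)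
    (haff : AffineIndependent ℝ (fun p : {x // x ∈ Ap} => (p : Fin n → ℝ)))
    (hAmne : Am.Nonempty)
    (hAmconv : (Am : Set (Fin n → ℝ)) ⊆ convexHull ℝ (Ap : Set (Fin n → ℝ)))
    (lam : (Fin n → ℝ) → (Fin n → ℝ) → ℝ)
    (hlam0 : ∀ b ∈ Am, ∀ a ∈ Ap, 0 ≤ lam b a)
    (hlam1 : ∀ b ∈ Am, ∑ a ∈ Ap, lam b a = 1)
    (hlamb : ∀ b ∈ Am, ∑ a ∈ Ap, lam b a • a = b)
    (c : (Fin n → ℝ) → ℝ) (hc : ∀ a ∈ Ap ∪ Am, 0 < c a)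
    (hsing : ∃ x : Fin n → ℝ, (∀ i, 0 < x i) ∧
      (∑ a ∈ Ap, c a * ∏ j, x j ^ a j - ∑ b ∈ Am, c b * ∏ j, x j ^ b j = 0) ∧
      ∀ i : Fin n, ∑ a ∈ Ap, c a * a i * ∏ j, x j ^ a j
        - ∑ b ∈ Am, c b * b i * ∏ j, x j ^ b j = 0) :
    ∃ d : (Fin n → ℝ) → (Fin n → ℝ) → ℝ,
      (∀ b ∈ Am, ∀ a ∈ Ap, 0 < lam b a → 0 < d b a) ∧
      (∀ x : Fin n → ℝ, (∀ i, 0 < x i) →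
        ∑ a ∈ Ap, c a * ∏ j, x j ^ a j - ∑ b ∈ Am, c b * ∏ j, x j ^ b j
          = ∑ b ∈ Am, (∑ a ∈ Ap.filter (fun a => 0 < lam b a),
              d b a * ∏ j, x j ^ a j - c b * ∏ j, x j ^ b j)) ∧
      (∀ b ∈ Am, ∀ x : Fin n → ℝ, (∀ i, 0 < x i) →
        0 ≤ ∑ a ∈ Ap.filter (fun a => 0 < lam b a),
              d b a * ∏ j, x j ^ a j - c b * ∏ j, x j ^ b j) := by
  obtain ⟨z, hz, hz0, hz1⟩ := hsing
  have hpos : ∀ {y : Fin n → ℝ}, (∀ i, 0 < y i) → ∀ a : Fin n → ℝ, 0 < ∏ j, y j ^ a j :=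
    fun hy a => Finset.prod_pos fun j _ => Real.rpow_pos_of_pos (hy j) _
  have hcoef : ∀ a ∈ Ap, c a * ∏ j, z j ^ a j
      = ∑ b ∈ Am, c b * (∏ j, z j ^ b j) * lam b a := by
    refine haff.eq_sum_mul_of_sum_smul_eq hlam1 hlamb (u := fun a => c a * ∏ j, z j ^ a j)
      (v := fun b => c b * ∏ j, z j ^ b j) (sub_eq_zero.1 hz0) ?_
    ext i
    simp only [Finset.sum_apply, Pi.smul_apply, smul_eq_mul]
    simpa only [mul_right_comm] using sub_eq_zero.1 (hz1 i)
  have hfilter : ∀ b ∈ Am, ∀ x : Fin n → ℝ,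
      ∑ a ∈ Ap.filter (fun a => 0 < lam b a),
        c b * (∏ j, z j ^ b j) * lam b a / (∏ j, z j ^ a j) * ∏ j, x j ^ a j =
      ∑ a ∈ Ap, c b * (∏ j, z j ^ b j) * lam b a / (∏ j, z j ^ a j) * ∏ j, x j ^ a j := by
    intro b hb x
    refine Finset.sum_filter_of_ne fun a ha hne => (hlam0 b hb a ha).lt_of_ne fun h => hne ?_
    simp [← h]
  refine ⟨fun b a => c b * (∏ j, z j ^ b j) * lam b a / ∏ j, z j ^ a j, ?_, ?_, ?_⟩
  · intro b hb a _ hl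
    have := hc b (Finset.mem_union_right _ hb)
    exact div_pos (mul_pos (mul_pos this (hpos hz b)) hl) (hpos hz a)
  · intro x _
    rw [Finset.sum_sub_distrib, Finset.sum_congr rfl fun b hb => hfilter b hb x, Finset.sum_comm]
    congr 1
    refine Finset.sum_congr rfl fun a ha => ?_
    rw [← Finset.sum_mul, ← Finset.sum_div, ← hcoef a ha, mul_div_cancel_right₀ _ (hpos hz a).ne']
  · intro b hb x hx
    have hcb := hc b (Finset.mem_union_right _ hb)
    have h := div_prod_rpow_le_sum_div Ap (lam b) (hlam0 b hb) (hlam1 b hb) hx hz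
    rw [hlamb b hb, div_le_iff₀ (hpos hz b)] at h
    rw [hfilter b hb x, sub_nonneg]
    refine (mul_le_mul_of_nonneg_left h hcb.le).trans_eq ?_
    rw [Finset.sum_mul, Finset.mul_sum]
    exact Finset.sum_congr rfl fun a _ => by ring
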